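/- Regge-trajectory asymptotics, even offset (consequence of the Regge asymptotics theorem of Section 5.3). Fix an even natural number Δ ≥ 0, an integer D ≥ 4, and real r > -1 and μ. Then there exists N such that for every integer n ≥ N (so in particular n ≥ Δ and n ≥ 3μ), B^1_{n,n-Δ}(r,μ,D) > 0. -/

import Mathlib

open MeasureTheory

/-- Rising factorial `(y)_(k) = y (y+1) ⋯ (y+k-1)`. -/
noncomputable def risingFactorial (y : ℝ) (k : ℕ) : ℝ := ∏ i ∈ Finset.range k, (y + i)

/-- Partial-wave coefficient `B^a_{n,j}(r,μ,D)` of the hypergeometric amplitude,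
normalized up to an inessential positive constant depending only on `j` and `D`. -/
noncomputable def B (a n j : ℕ) (r μ D : ℝ) : ℝ :=
  (1 / risingFactorial (r + 1) n) *
    ∫ x in (-1:ℝ)..1,
      (1 - x ^ 2) ^ ((D - 4) / 2 + (j : ℝ)) *
        iteratedDeriv j
          (fun y : ℝ =>
            risingFactorial (((n : ℝ) - 3 * μ) * y / 2 + (μ - (n : ℝ)) / 2 + r + 1) (n - 1 + a)) x

open Filter Topology Finset

/-- The `i`-th of `n` equally spaced unit-step points, centred at the origin. -/
noncomputable def centredNode (n i : ℕ) : ℝ := (i : ℝ) - ((n : ℝ) - 1) / 2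

noncomputable def nodeEsymm (n k : ℕ) : ℝ :=
  (Multiset.map (fun i : Fin n => centredNode n i) Finset.univ.val).esymm k

noncomputable def nodePsum (n k : ℕ) : ℝ := ∑ i ∈ range n, centredNode n i ^ k

/-- The limit of `nodeEsymm n k / √n ^ (3 * k)`. -/
noncomputable def esymmLimit : ℕ → ℝ
  | 0 => 1
  | 1 => 0
  | k + 2 => -esymmLimit k / (12 * (k + 2))

/-- The limit of `√n ^ k` times the normalized `k`-th moment of `(1 - x ^ 2) ^ n`, that is, the
moments of the Gaussian density `exp (-t ^ 2) / √π`. -/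
noncomputable def gaussMoment : ℕ → ℝ
  | 0 => 1
  | 1 => 0
  | k + 2 => (k + 1) / 2 * gaussMoment k

lemma nodeEsymm_zero (n : ℕ) : nodeEsymm n 0 = 1 := by
  simp [nodeEsymm, Multiset.esymm]

lemma prod_add_centredNode (n : ℕ) (z : ℝ) :
    ∏ i ∈ range n, (z + centredNode n i) =
      ∑ k ∈ range (n + 1), nodeEsymm n k * z ^ (n - k) := by
  have h := congrArg (Polynomial.eval z) (Multiset.prod_X_add_C_eq_sum_esymm
    (Multiset.map (fun i : Fin n => centredNode n i) Finset.univ.val))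
  simp only [Multiset.map_map, Polynomial.eval_finsetSum, Multiset.card_map, Polynomial.eval_mul,
    Polynomial.eval_C, Polynomial.eval_pow, Polynomial.eval_X, Finset.card_val, Finset.card_univ,
    Fintype.card_fin] at h
  rw [Finset.prod_range]
  refine Eq.trans ?_ h
  change _ = Polynomial.eval z
    (∏ i : Fin n, (Polynomial.X + Polynomial.C (centredNode n i)))
  simp [Polynomial.eval_prod]

lemma mul_nodeEsymm (n k : ℕ) :
    (k : ℝ) * nodeEsymm n k = (-1) ^ (k + 1) *
      ∑ a ∈ antidiagonal k with a.1 < k, (-1) ^ a.1 * nodeEsymm n a.1 * nodePsum n a.2 := by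
  have h := congrArg (MvPolynomial.aeval (fun i : Fin n => centredNode n i))
    (MvPolynomial.mul_esymm_eq_sum (Fin n) ℝ k)
  simp only [map_mul, map_natCast, map_pow, map_neg, map_one, map_sum,
    MvPolynomial.aeval_esymm_eq_multiset_esymm, MvPolynomial.psum, MvPolynomial.aeval_X] at h
  simpa only [nodeEsymm, nodePsum, Finset.sum_range] using h

lemma sum_range_centredNode (n m : ℕ) :
    ∑ i ∈ range m, centredNode n i = (m : ℝ) * (m - n) / 2 := by
  induction m with
  | zero => simp
  | succ m ih => rw [sum_range_succ, ih, centredNode]; push_cast; ring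

lemma sum_range_centredNode_sq (n m : ℕ) :
    ∑ i ∈ range m, centredNode n i ^ 2 =
      (m : ℝ) * ((m - 1) * (2 * m - 1) / 6 - (n - 1) * (m - 1) / 2 + (n - 1) ^ 2 / 4) := by
  induction m with
  | zero => simp
  | succ m ih => rw [sum_range_succ, ih, centredNode]; push_cast; ring

lemma abs_centredNode_le {n i : ℕ} (h : i < n) : |centredNode n i| ≤ n := by
  have h1 : (i : ℝ) + 1 ≤ n := by exact_mod_cast h
  have h2 : (0 : ℝ) ≤ i := i.cast_nonneg
  rw [centredNode, abs_le]
  constructor <;> linarith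

lemma tendsto_sqrt_natCast : Tendsto (fun n : ℕ => √(n : ℝ)) atTop atTop :=
  Real.tendsto_sqrt_atTop.comp tendsto_natCast_atTop_atTop

lemma tendsto_nodePsum {k : ℕ} (hk : k ≠ 0) :
    Tendsto (fun n : ℕ => nodePsum n k / √(n : ℝ) ^ (3 * k)) atTop
      (𝓝 (if k = 2 then 1 / 12 else 0)) := by
  obtain rfl | rfl | hk3 : k = 1 ∨ k = 2 ∨ 3 ≤ k := by omega
  · simp [nodePsum, sum_range_centredNode]
  · have h : Tendsto (fun n : ℕ => (1 - ((n : ℝ)⁻¹) ^ 2) / 12) atTop (𝓝 ((1 - 0 ^ 2) / 12)) :=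
      (((tendsto_inv_atTop_nhds_zero_nat (𝕜 := ℝ)).pow 2).const_sub 1).div_const 12
    simp only [if_true]
    norm_num at h ⊢
    refine h.congr' ?_
    filter_upwards [eventually_gt_atTop 0] with n hn
    have hn' : (0 : ℝ) < n := by exact_mod_cast hn
    have hs : √(n : ℝ) ^ 6 = (n : ℝ) ^ 3 := by
      rw [show 6 = 2 * 3 by rfl, pow_mul, Real.sq_sqrt hn'.le]
    rw [hs, nodePsum, sum_range_centredNode_sq]
    field_simp
    ring
  · rw [if_neg (by omega)]
    have h0 : Tendsto (fun n : ℕ => (√(n : ℝ))⁻¹) atTop (𝓝 0) :=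
      tendsto_inv_atTop_zero.comp tendsto_sqrt_natCast
    refine squeeze_zero_norm' ?_ h0
    filter_upwards [eventually_gt_atTop 0] with n hn
    have hn1 : (1 : ℝ) ≤ n := by exact_mod_cast hn
    have hs1 : 1 ≤ √(n : ℝ) := Real.one_le_sqrt.2 hn1
    have hsq : √(n : ℝ) ^ 2 = n := Real.sq_sqrt (by linarith)
    have hb : |nodePsum n k| ≤ √(n : ℝ) ^ (2 * (k + 1)) := by
      calc |nodePsum n k| ≤ ∑ i ∈ range n, |centredNode n i ^ k| := abs_sum_le_sum_abs _ _
        _ ≤ ∑ i ∈ range n, (n : ℝ) ^ k := by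
            refine sum_le_sum fun i hi => ?_
            rw [abs_pow]
            exact pow_le_pow_left₀ (abs_nonneg _) (abs_centredNode_le (mem_range.1 hi)) k
        _ = √(n : ℝ) ^ (2 * (k + 1)) := by
            rw [pow_mul, hsq, sum_const, card_range, nsmul_eq_mul, pow_succ]; ring
    have hpos : (0 : ℝ) < √(n : ℝ) := by linarith
    rw [Real.norm_eq_abs, abs_div, abs_of_pos (pow_pos hpos (3 * k)), div_le_iff₀ (by positivity)]
    refine hb.trans ?_
    rw [show 3 * k = (3 * k - 1) + 1 by omega, pow_succ', inv_mul_cancel_left₀ hpos.ne']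
    exact pow_le_pow_right₀ hs1 (by omega)

lemma tendsto_nodeEsymm (k : ℕ) :
    Tendsto (fun n : ℕ => nodeEsymm n k / √(n : ℝ) ^ (3 * k)) atTop (𝓝 (esymmLimit k)) := by
  induction k using Nat.strong_induction_on with
  | _ k ih =>
  rcases Nat.eq_zero_or_pos k with rfl | hk
  · simp [nodeEsymm_zero, esymmLimit]
  have hk' : (k : ℝ) ≠ 0 := by exact_mod_cast hk.ne'
  have hlim : Tendsto (fun n : ℕ => (k : ℝ)⁻¹ * ((-1) ^ (k + 1) *
      ∑ a ∈ antidiagonal k with a.1 < k, (-1) ^ a.1 * (nodeEsymm n a.1 / √(n : ℝ) ^ (3 * a.1)) *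
        (nodePsum n a.2 / √(n : ℝ) ^ (3 * a.2)))) atTop
      (𝓝 ((k : ℝ)⁻¹ * ((-1) ^ (k + 1) * ∑ a ∈ antidiagonal k with a.1 < k,
        (-1) ^ a.1 * esymmLimit a.1 * (if a.2 = 2 then 1 / 12 else 0)))) := by
    refine Tendsto.const_mul _ (Tendsto.const_mul _ (tendsto_finsetSum _ fun a ha => ?_))
    simp only [mem_filter, HasAntidiagonal.mem_antidiagonal] at ha
    exact ((ih a.1 ha.2).const_mul _).mul (tendsto_nodePsum (by omega))
  have hval : (k : ℝ)⁻¹ * ((-1) ^ (k + 1) * ∑ a ∈ antidiagonal k with a.1 < k,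
      (-1) ^ a.1 * esymmLimit a.1 * (if a.2 = 2 then 1 / 12 else 0)) = esymmLimit k := by
    obtain rfl | ⟨m, rfl⟩ : k = 1 ∨ ∃ m, k = m + 2 := by
      rcases k with _ | _ | m
      · omega
      · simp
      · exact Or.inr ⟨m, rfl⟩
    · rw [sum_eq_zero]
      · simp [esymmLimit]
      · intro a ha
        simp only [mem_filter, HasAntidiagonal.mem_antidiagonal] at ha
        rw [if_neg (by omega), mul_zero]
    · rw [sum_eq_single (m, 2)]
      · have hm : ((-1 : ℝ) ^ m) * (-1) ^ m = 1 := by rw [← mul_pow]; norm_num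
        simp only [if_true, esymmLimit]
        have : (m : ℝ) + 2 ≠ 0 := by positivity
        push_cast
        field_simp
        linear_combination (-esymmLimit m) * hm
      · intro a ha hne
        simp only [mem_filter, HasAntidiagonal.mem_antidiagonal] at ha
        rw [if_neg, mul_zero]
        intro h2
        exact hne (Prod.ext (by simp only; omega) h2)
      · intro h
        simp at h
  rw [← hval]
  refine hlim.congr fun n => ?_
  rw [← inv_mul_cancel_left₀ hk' (nodeEsymm n k), mul_nodeEsymm n k, mul_div_assoc, mul_div_assoc,
    sum_div]
  congr 2
  refine sum_congr rfl fun a ha => ?_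
  simp only [mem_filter, HasAntidiagonal.mem_antidiagonal] at ha
  rw [← ha.1, mul_add, pow_add]
  simp only [div_eq_mul_inv, mul_inv]
  ring

lemma esymmLimit_odd (m : ℕ) : esymmLimit (2 * m + 1) = 0 := by
  induction m with
  | zero => rfl
  | succ m ih =>
    rw [show 2 * (m + 1) + 1 = (2 * m + 1) + 2 by ring, esymmLimit, ih]; simp

lemma esymmLimit_even (m : ℕ) : esymmLimit (2 * m) = (-1 / 24) ^ m / m.factorial := by
  induction m with
  | zero => simp [esymmLimit]
  | succ m ih =>
    rw [show 2 * (m + 1) = 2 * m + 2 by ring, esymmLimit, ih, Nat.factorial_succ]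
    push_cast
    have : (m : ℝ) + 1 ≠ 0 := by positivity
    have : (m.factorial : ℝ) ≠ 0 := by positivity
    field_simp
    ring

lemma gaussMoment_even (m : ℕ) :
    gaussMoment (2 * m) / (2 * m).factorial = (1 / 4) ^ m / m.factorial := by
  induction m with
  | zero => simp [gaussMoment]
  | succ m ih =>
    rw [show 2 * (m + 1) = 2 * m + 2 by ring, gaussMoment, Nat.factorial_succ, Nat.factorial_succ,
      Nat.factorial_succ, pow_succ]
    have h1 : ((2 * m).factorial : ℝ) ≠ 0 := by positivity
    rw [div_eq_iff h1] at ih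
    rw [ih]
    push_cast
    have : (m : ℝ) + 1 ≠ 0 := by positivity
    have : (m.factorial : ℝ) ≠ 0 := by positivity
    field_simp
    ring

lemma sum_range_two_mul_add_one_of_odd_zero {f : ℕ → ℝ} (hf : ∀ m, f (2 * m + 1) = 0) (h : ℕ) :
    ∑ k ∈ range (2 * h + 1), f k = ∑ m ∈ range (h + 1), f (2 * m) := by
  induction h with
  | zero => simp
  | succ h ih =>
    rw [show 2 * (h + 1) + 1 = 2 * h + 1 + 1 + 1 by ring, sum_range_succ, sum_range_succ, ih, hf,
      sum_range_succ _ (h + 1)]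
    ring_nf

lemma sum_esymmLimit_mul_gaussMoment_pos (h : ℕ) :
    0 < ∑ k ∈ range (2 * h + 1), esymmLimit k *
      ((1 / 2) ^ (2 * h - k) * gaussMoment (2 * h - k) / (2 * h - k).factorial) := by
  rw [sum_range_two_mul_add_one_of_odd_zero (fun m => by rw [esymmLimit_odd, zero_mul])]
  have key : ∑ m ∈ range (h + 1), esymmLimit (2 * m) *
      ((1 / 2) ^ (2 * h - 2 * m) * gaussMoment (2 * h - 2 * m) / (2 * h - 2 * m).factorial) =
      (1 / 48) ^ h / h.factorial := by
    rw [show (1 / 48 : ℝ) = -1 / 24 + 1 / 16 by norm_num, add_pow, sum_div]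
    refine sum_congr rfl fun m hm => ?_
    have hm' : m ≤ h := by simpa [Nat.lt_succ_iff] using hm
    rw [← Nat.mul_sub, mul_div_assoc, gaussMoment_even, esymmLimit_even, pow_mul,
      Nat.cast_choose ℝ hm', show (1 / 16 : ℝ) = (1 / 2) ^ 2 * (1 / 4) by norm_num, mul_pow]
    have : (h.factorial : ℝ) ≠ 0 := by positivity
    field_simp
  rw [key]
  positivity

/-- The `k`-th moment of the weight `(1 - x ^ 2) ^ β` on `[-1, 1]`. -/
noncomputable def gegenbauerMoment (β : ℝ) (k : ℕ) : ℝ :=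
  ∫ x in (-1 : ℝ)..1, (1 - x ^ 2) ^ β * x ^ k

lemma continuous_one_sub_sq_rpow {β : ℝ} (hβ : 0 ≤ β) :
    Continuous fun x : ℝ => (1 - x ^ 2) ^ β :=
  (by fun_prop : Continuous fun x : ℝ => 1 - x ^ 2).rpow_const fun _ => Or.inr hβ

lemma intervalIntegrable_weight_mul {β : ℝ} (hβ : 0 ≤ β) {f : ℝ → ℝ} (hf : Continuous f) :
    IntervalIntegrable (fun x => (1 - x ^ 2) ^ β * f x) volume (-1) 1 :=
  ((continuous_one_sub_sq_rpow hβ).mul hf).intervalIntegrable _ _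

lemma gegenbauerMoment_zero_pos {β : ℝ} (hβ : 0 ≤ β) : 0 < gegenbauerMoment β 0 := by
  refine intervalIntegral.intervalIntegral_pos_of_pos_on
    (intervalIntegrable_weight_mul hβ (continuous_pow 0)) (fun x hx => ?_) (by norm_num)
  have : 0 < 1 - x ^ 2 := by nlinarith [hx.1, hx.2]
  positivity

lemma hasDerivAt_one_sub_sq_rpow {β : ℝ} (hβ : 0 ≤ β) (x : ℝ) :
    HasDerivAt (fun y : ℝ => (1 - y ^ 2) ^ (β + 1))
      (-(2 * (β + 1)) * ((1 - x ^ 2) ^ β * x)) x := by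
  have h : HasDerivAt (fun y : ℝ => 1 - y ^ 2) (-(2 * x)) x := by
    simpa using (hasDerivAt_pow 2 x).const_sub 1
  convert h.rpow_const (p := β + 1) (Or.inr (by linarith)) using 1
  rw [add_sub_cancel_right]
  ring

lemma gegenbauerMoment_one {β : ℝ} (hβ : 0 ≤ β) : gegenbauerMoment β 1 = 0 := by
  have h := intervalIntegral.integral_eq_sub_of_hasDerivAt (a := -1) (b := 1)
    (fun x _ => hasDerivAt_one_sub_sq_rpow hβ x)
    ((intervalIntegrable_weight_mul hβ continuous_id).const_mul _)
  rw [intervalIntegral.integral_const_mul] at h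
  have hβ' : β + 1 ≠ 0 := by linarith
  simpa [gegenbauerMoment, Real.zero_rpow hβ', hβ'] using h

lemma gegenbauerMoment_add_two {β : ℝ} (hβ : 0 ≤ β) (k : ℕ) :
    gegenbauerMoment β (k + 2) = (k + 1) / (2 * β + k + 3) * gegenbauerMoment β k := by
  have hd : ∀ x ∈ Set.uIcc (-1 : ℝ) 1, HasDerivAt (fun y : ℝ => (1 - y ^ 2) ^ (β + 1) * y ^ (k + 1))
      ((k + 1) * ((1 - x ^ 2) ^ β * x ^ k) -
        (2 * β + k + 3) * ((1 - x ^ 2) ^ β * x ^ (k + 2))) x := by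
    intro x hx
    rw [Set.uIcc_of_le (by norm_num)] at hx
    have hx' : 0 ≤ 1 - x ^ 2 := by nlinarith [hx.1, hx.2]
    refine ((hasDerivAt_one_sub_sq_rpow hβ x).mul (hasDerivAt_pow (k + 1) x)).congr_deriv ?_
    rw [Real.rpow_add_one' hx' (by linarith)]
    push_cast
    ring
  have h1 := (intervalIntegrable_weight_mul hβ (continuous_pow k)).const_mul ((k : ℝ) + 1)
  have h2 := (intervalIntegrable_weight_mul hβ (continuous_pow (k + 2))).const_mul
    (2 * β + k + 3)
  have h := intervalIntegral.integral_eq_sub_of_hasDerivAt (a := -1) (b := 1)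
    hd (h1.sub h2)
  rw [intervalIntegral.integral_sub h1 h2, intervalIntegral.integral_const_mul,
    intervalIntegral.integral_const_mul] at h
  have hβ' : β + 1 ≠ 0 := by linarith
  norm_num [Real.zero_rpow hβ'] at h
  have hpos : 2 * β + k + 3 ≠ 0 := by positivity
  rw [div_mul_eq_mul_div, eq_div_iff hpos, gegenbauerMoment, gegenbauerMoment]
  linarith

lemma tendsto_gegenbauerMoment {b : ℕ → ℝ} (hb : ∀ n, 0 ≤ b n)
    (hlim : Tendsto (fun n : ℕ => b n / n) atTop (𝓝 1)) (k : ℕ) :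
    Tendsto (fun n : ℕ => √(n : ℝ) ^ k * (gegenbauerMoment (b n) k / gegenbauerMoment (b n) 0))
      atTop (𝓝 (gaussMoment k)) := by
  induction k using Nat.twoStepInduction with
  | zero => simp [div_self (gegenbauerMoment_zero_pos (hb _)).ne', gaussMoment]
  | one => simp [gegenbauerMoment_one (hb _), gaussMoment]
  | more k ih _ =>
    have h1 : Tendsto (fun n : ℕ => ((k : ℝ) + 1) / (2 * (b n / n) + (k + 3) * (n : ℝ)⁻¹)) atTop
        (𝓝 ((k + 1) / (2 * 1 + (k + 3) * 0))) :=
      tendsto_const_nhds.div ((hlim.const_mul 2).add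
        (tendsto_inv_atTop_nhds_zero_nat.const_mul _)) (by norm_num)
    have h2 := h1.mul ih
    rw [mul_one, mul_zero, add_zero] at h2
    refine h2.congr' ?_
    filter_upwards [eventually_gt_atTop 0] with n hn
    have hn' : (0 : ℝ) < n := by exact_mod_cast hn
    have hpos : 2 * b n + k + 3 ≠ 0 := by have := hb n; positivity
    have hd : 2 * (b n / n) + (k + 3) * (n : ℝ)⁻¹ = (2 * b n + k + 3) / n := by
      field_simp
      ring
    rw [gegenbauerMoment_add_two (hb n), hd, pow_add, Real.sq_sqrt hn'.le]
    field_simp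

lemma integral_weight_mul_affine_pow {β : ℝ} (hβ : 0 ≤ β) (A c : ℝ) (q : ℕ) :
    ∫ x in (-1 : ℝ)..1, (1 - x ^ 2) ^ β * (A * x + c) ^ q =
      ∑ i ∈ range (q + 1), A ^ i * c ^ (q - i) * q.choose i * gegenbauerMoment β i := by
  simp only [gegenbauerMoment, ← intervalIntegral.integral_const_mul]
  rw [← intervalIntegral.integral_finsetSum fun i _ =>
    (intervalIntegrable_weight_mul hβ (continuous_pow i)).const_mul _]
  refine intervalIntegral.integral_congr fun x _ => ?_
  simp only [add_pow, mul_sum, mul_pow]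
  exact sum_congr rfl fun i _ => by ring

lemma tendsto_integral_weight_mul_affine_pow {b A : ℕ → ℝ} (hb : ∀ n, 0 ≤ b n)
    (hlim : Tendsto (fun n : ℕ => b n / n) atTop (𝓝 1)) {a : ℝ}
    (hA : Tendsto (fun n : ℕ => A n / n) atTop (𝓝 a)) (c : ℝ) (q : ℕ) :
    Tendsto (fun n : ℕ => (∫ x in (-1 : ℝ)..1, (1 - x ^ 2) ^ b n * (A n * x + c) ^ q) /
      gegenbauerMoment (b n) 0 / √(n : ℝ) ^ q) atTop (𝓝 (a ^ q * gaussMoment q)) := by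
  have h0 : Tendsto (fun n : ℕ => (√(n : ℝ))⁻¹) atTop (𝓝 0) :=
    tendsto_inv_atTop_zero.comp tendsto_sqrt_natCast
  have h : Tendsto (fun n : ℕ => ∑ i ∈ range (q + 1), (A n / n) ^ i *
      (c * (√(n : ℝ))⁻¹) ^ (q - i) * q.choose i *
        (√(n : ℝ) ^ i * (gegenbauerMoment (b n) i / gegenbauerMoment (b n) 0))) atTop
      (𝓝 (∑ i ∈ range (q + 1), a ^ i * (c * 0) ^ (q - i) * q.choose i * gaussMoment i)) :=
    tendsto_finsetSum _ fun i _ => (((hA.pow i).mul ((h0.const_mul c).pow _)).mul_const _).mul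
      (tendsto_gegenbauerMoment hb hlim i)
  rw [sum_range_succ, sum_eq_zero, zero_add] at h
  · simp only [Nat.sub_self, pow_zero, mul_one, Nat.choose_self, Nat.cast_one] at h
    refine h.congr' ?_
    filter_upwards [eventually_gt_atTop 0] with n hn
    have hn' : (0 : ℝ) < n := by exact_mod_cast hn
    have hs : 0 < √(n : ℝ) := Real.sqrt_pos.2 hn'
    rw [integral_weight_mul_affine_pow (hb n), sum_div, sum_div]
    refine sum_congr rfl fun i hi => ?_
    have hiq : i ≤ q := by simpa [Nat.lt_succ_iff] using hi
    obtain ⟨m, rfl⟩ := Nat.exists_eq_add_of_le hiq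
    have hg := (gegenbauerMoment_zero_pos (hb n)).ne'
    have hsn : (n : ℝ) ^ i = √(n : ℝ) ^ i * √(n : ℝ) ^ i := by
      rw [← mul_pow, Real.mul_self_sqrt hn'.le]
    rw [Nat.add_sub_cancel_left, div_pow, mul_pow, inv_pow, hsn, pow_add]
    field_simp
  · intro i hi
    have : q - i ≠ 0 := by have := mem_range.1 hi; omega
    simp [this]

lemma risingFactorial_affine (n : ℕ) (r μ y : ℝ) :
    risingFactorial (((n : ℝ) - 3 * μ) * y / 2 + (μ - (n : ℝ)) / 2 + r + 1) n =
      ∑ k ∈ range (n + 1), nodeEsymm n k *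
        (((n : ℝ) - 3 * μ) / 2 * y + (μ / 2 + r + 1 / 2)) ^ (n - k) := by
  rw [← prod_add_centredNode, risingFactorial]
  refine prod_congr rfl fun i _ => ?_
  rw [centredNode]
  ring

lemma iteratedDeriv_affine_pow (A c : ℝ) (m j : ℕ) (x : ℝ) :
    iteratedDeriv j (fun y => (A * y + c) ^ m) x =
      A ^ j * ((m.descFactorial j : ℝ) * (A * x + c) ^ (m - j)) := by
  have h := congrFun (iteratedDeriv_comp_const_mul (n := j) (f := fun z : ℝ => (z + c) ^ m)
    (by fun_prop) A) x
  rw [h, congrFun (iteratedDeriv_comp_add_const j (fun z : ℝ => z ^ m) c) (A * x),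
    iteratedDeriv_pow]

lemma iteratedDeriv_risingFactorial_affine {Δ n : ℕ} (hn : Δ ≤ n) (r μ x : ℝ) :
    iteratedDeriv (n - Δ) (fun y : ℝ =>
      risingFactorial (((n : ℝ) - 3 * μ) * y / 2 + (μ - (n : ℝ)) / 2 + r + 1) n) x =
    (((n : ℝ) - 3 * μ) / 2) ^ (n - Δ) * ∑ k ∈ range (Δ + 1),
      nodeEsymm n k * (((n - k).descFactorial (n - Δ) : ℝ) *
        (((n : ℝ) - 3 * μ) / 2 * x + (μ / 2 + r + 1 / 2)) ^ (Δ - k)) := by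
  simp only [risingFactorial_affine]
  rw [iteratedDeriv_fun_sum fun i _ => by fun_prop, mul_sum]
  simp only [iteratedDeriv_const_mul_field, iteratedDeriv_affine_pow]
  symm
  have hsub : range (Δ + 1) ⊆ range (n + 1) := range_subset_range.2 (by omega)
  rw [← sum_subset hsub]
  · refine sum_congr rfl fun k hk => ?_
    rw [show n - k - (n - Δ) = Δ - k by have := mem_range.1 hk; omega]
    ring
  · intro k hk hk'
    rw [mem_range] at hk hk'
    rw [Nat.descFactorial_of_lt (by omega)]
    simp

lemma tendsto_pow_mul_descFactorial_div (Δ k : ℕ) (hk : k ≤ Δ) :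
    Tendsto (fun n : ℕ => (n : ℝ) ^ k * (n - k).descFactorial (n - Δ) / n.factorial) atTop
      (𝓝 (1 / (Δ - k).factorial)) := by
  have hz : ∀ᶠ n : ℕ in atTop, ((n.descFactorial k : ℕ) : ℝ) ≠ 0 := by
    filter_upwards [eventually_ge_atTop k] with n hn
    exact_mod_cast (Nat.descFactorial_pos.2 hn).ne'
  have h := ((Asymptotics.isEquivalent_iff_tendsto_one hz).1
    (isEquivalent_descFactorial k).symm).div_const ((Δ - k).factorial : ℝ)
  refine h.congr' ?_
  filter_upwards [eventually_ge_atTop Δ, hz] with n hn hz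
  have h1 := Nat.factorial_mul_descFactorial (n := n) (k := k) (by omega)
  have h2 := Nat.factorial_mul_descFactorial (n := n - k) (k := n - Δ) (by omega)
  rw [show n - k - (n - Δ) = Δ - k by omega] at h2
  rw [← h1, ← h2]
  have hd : ((n - k).descFactorial (n - Δ) : ℝ) ≠ 0 := by
    exact_mod_cast (Nat.descFactorial_pos.2 (by omega : n - Δ ≤ n - k)).ne'
  push_cast
  simp only [Pi.div_apply]
  field_simp

lemma B_one_sub_eq {Δ n : ℕ} (hn : Δ ≤ n) (hn1 : 1 ≤ n) (r μ D : ℝ) (hD : 4 ≤ D) :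
    B 1 n (n - Δ) r μ D = 1 / risingFactorial (r + 1) n *
      ((((n : ℝ) - 3 * μ) / 2) ^ (n - Δ) * ∑ k ∈ range (Δ + 1),
        nodeEsymm n k * (((n - k).descFactorial (n - Δ) : ℝ) *
          ∫ x in (-1 : ℝ)..1, (1 - x ^ 2) ^ ((D - 4) / 2 + ((n - Δ : ℕ) : ℝ)) *
            (((n : ℝ) - 3 * μ) / 2 * x + (μ / 2 + r + 1 / 2)) ^ (Δ - k))) := by
  have hβ : 0 ≤ (D - 4) / 2 + ((n - Δ : ℕ) : ℝ) := by
    have : (0 : ℝ) ≤ ((n - Δ : ℕ) : ℝ) := Nat.cast_nonneg _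
    linarith
  rw [B, Nat.sub_add_cancel hn1]
  congr 1
  simp only [← intervalIntegral.integral_const_mul]
  rw [← intervalIntegral.integral_finsetSum, ← intervalIntegral.integral_const_mul]
  · refine intervalIntegral.integral_congr fun x _ => ?_
    simp only [iteratedDeriv_risingFactorial_affine hn, mul_sum]
    exact sum_congr rfl fun k _ => by ring
  · intro k _
    exact ((intervalIntegrable_weight_mul hβ (by fun_prop)).const_mul _).const_mul _

lemma risingFactorial_pos {y : ℝ} (hy : 0 < y) (n : ℕ) : 0 < risingFactorial y n :=
  prod_pos fun i _ => by positivity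

/-- Regge-trajectory asymptotics (Section 5.3), even offset: for fixed even `Δ`,
the coefficients `B^1_{n,n-Δ}` are eventually strictly positive. -/
theorem regge_asymptotics_even (Δ : ℕ) (hΔ : Even Δ) (D : ℤ) (hD : 4 ≤ D)
    (r μ : ℝ) (hr : -1 < r) :
    ∃ N : ℕ, Δ ≤ N ∧ 3 * μ ≤ (N : ℝ) ∧
      ∀ n : ℕ, N ≤ n → 0 < B 1 n (n - Δ) r μ (D : ℝ) := by
  have hD' : (4 : ℝ) ≤ D := by exact_mod_cast hD
  set b : ℕ → ℝ := fun n => ((D : ℝ) - 4) / 2 + ((n - Δ : ℕ) : ℝ) with hb_def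
  set A : ℕ → ℝ := fun n => ((n : ℝ) - 3 * μ) / 2 with hA_def
  set c : ℝ := μ / 2 + r + 1 / 2
  have hb : ∀ n, 0 ≤ b n := fun n => by
    have : (0 : ℝ) ≤ ((n - Δ : ℕ) : ℝ) := Nat.cast_nonneg _
    simp only [hb_def]
    linarith
  have hinv := tendsto_inv_atTop_nhds_zero_nat (𝕜 := ℝ)
  have hblim : Tendsto (fun n : ℕ => b n / n) atTop (𝓝 1) := by
    have h := (hinv.const_mul (((D : ℝ) - 4) / 2 - Δ)).const_add 1
    rw [mul_zero, add_zero] at h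
    refine h.congr' ?_
    filter_upwards [eventually_ge_atTop Δ, eventually_gt_atTop 0] with n hn hn0
    have hn' : (n : ℝ) ≠ 0 := by exact_mod_cast hn0.ne'
    simp only [hb_def, Nat.cast_sub hn]
    field_simp
    ring
  have hAlim : Tendsto (fun n : ℕ => A n / n) atTop (𝓝 (1 / 2)) := by
    have h := (hinv.const_mul (-(3 * μ) / 2)).const_add (1 / 2)
    rw [mul_zero, add_zero] at h
    refine h.congr' ?_
    filter_upwards [eventually_gt_atTop 0] with n hn0
    have hn' : (n : ℝ) ≠ 0 := by exact_mod_cast hn0.ne'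
    simp only [hA_def]
    field_simp
    ring
  have hsum : Tendsto (fun n : ℕ => ∑ k ∈ range (Δ + 1),
      (nodeEsymm n k / √(n : ℝ) ^ (3 * k)) *
        (((n : ℝ) ^ k * (n - k).descFactorial (n - Δ) / n.factorial) *
          ((∫ x in (-1 : ℝ)..1, (1 - x ^ 2) ^ b n * (A n * x + c) ^ (Δ - k)) /
            gegenbauerMoment (b n) 0 / √(n : ℝ) ^ (Δ - k)))) atTop
      (𝓝 (∑ k ∈ range (Δ + 1), esymmLimit k *
        (1 / (Δ - k).factorial * ((1 / 2) ^ (Δ - k) * gaussMoment (Δ - k))))) :=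
    tendsto_finsetSum _ fun k hk => (tendsto_nodeEsymm k).mul
      ((tendsto_pow_mul_descFactorial_div Δ k (Nat.lt_succ_iff.1 (mem_range.1 hk))).mul
        (tendsto_integral_weight_mul_affine_pow hb hblim hAlim c _))
  have hpos : 0 < ∑ k ∈ range (Δ + 1), esymmLimit k *
      (1 / (Δ - k).factorial * ((1 / 2) ^ (Δ - k) * gaussMoment (Δ - k))) := by
    obtain ⟨h, rfl⟩ := hΔ.two_dvd
    convert sum_esymmLimit_mul_gaussMoment_pos h using 3
    ring
  obtain ⟨N₀, hN₀⟩ := eventually_atTop.1 (hsum.eventually (lt_mem_nhds hpos))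
  obtain ⟨N₁, hN₁⟩ := exists_nat_gt (3 * μ)
  refine ⟨max (max Δ 1) (max N₀ N₁), by simp, ?_, fun n hn => ?_⟩
  · exact hN₁.le.trans (by exact_mod_cast (le_max_right N₀ N₁).trans (le_max_right _ _))
  simp only [max_le_iff] at hn
  obtain ⟨⟨hnΔ, hn1⟩, hn0, hnN⟩ := hn
  have hA : 0 < A n := by
    have : (N₁ : ℝ) ≤ n := by exact_mod_cast hnN
    simp only [hA_def]
    linarith
  have hg := gegenbauerMoment_zero_pos (hb n)
  have hn' : (0 : ℝ) < n := by exact_mod_cast hn1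
  have hs : 0 < √(n : ℝ) := Real.sqrt_pos.2 hn'
  rw [B_one_sub_eq hnΔ hn1 r μ D hD']
  refine mul_pos (one_div_pos.2 (risingFactorial_pos (by linarith) n)) (mul_pos (pow_pos hA _) ?_)
  have hscale : 0 < √(n : ℝ) ^ Δ * n.factorial * gegenbauerMoment (b n) 0 := by positivity
  refine (mul_pos hscale (hN₀ n hn0)).trans_eq ?_
  rw [mul_sum]
  refine sum_congr rfl fun k hk => ?_
  obtain ⟨m, rfl⟩ := Nat.exists_eq_add_of_le (Nat.lt_succ_iff.1 (mem_range.1 hk))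
  have hsn : (n : ℝ) ^ k = √(n : ℝ) ^ k * √(n : ℝ) ^ k := by
    rw [← mul_pow, Real.mul_self_sqrt hn'.le]
  have hs3 : √(n : ℝ) ^ (3 * k) = √(n : ℝ) ^ k * √(n : ℝ) ^ k * √(n : ℝ) ^ k := by ring
  rw [Nat.add_sub_cancel_left, hsn, hs3, pow_add]
  change _ = _ * (_ * ∫ x in (-1 : ℝ)..1, (1 - x ^ 2) ^ b n * (A n * x + c) ^ m)
  generalize (∫ x in (-1 : ℝ)..1, (1 - x ^ 2) ^ b n * (A n * x + c) ^ m) = I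
  field_simp
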